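/- The plactic monoid M with three generators is a subdirect product of its quotients N1 and N2: the monoid homomorphism M →* N1 × N2 whose components are the two natural quotient projections M → N1 and M → N2 is injective (and each component is surjective). -/

import Mathlib

namespace Plactic

/-- The generator `a`. -/
def a : FreeMonoid (Fin 3) := FreeMonoid.of 0
/-- The generator `b`. -/
def b : FreeMonoid (Fin 3) := FreeMonoid.of 1
/-- The generator `c`. -/
def c : FreeMonoid (Fin 3) := FreeMonoid.of 2

/-- The eight Knuth relations on three generators. -/
inductive KnuthRel : FreeMonoid (Fin 3) → FreeMonoid (Fin 3) → Prop
  | aba : KnuthRel (a * b * a) (b * a * a)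
  | bab : KnuthRel (b * a * b) (b * b * a)
  | aca : KnuthRel (a * c * a) (c * a * a)
  | cac : KnuthRel (c * a * c) (c * c * a)
  | cbb : KnuthRel (c * b * b) (b * c * b)
  | cbc : KnuthRel (c * b * c) (c * c * b)
  | bac : KnuthRel (b * a * c) (b * c * a)
  | acb : KnuthRel (a * c * b) (c * a * b)

/-- The plactic congruence: the congruence generated by the Knuth relations. -/
def placticCon : Con (FreeMonoid (Fin 3)) := conGen KnuthRel

/-- The plactic monoid with three generators. -/
abbrev M := placticCon.Quotient

/-- The natural projection from the free monoid onto the plactic monoid. -/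
def mk : FreeMonoid (Fin 3) →* M := placticCon.mk'

/-- The congruence on `M` generated by the pair `(ac, ca)`. -/
def con1 : Con M := conGen (fun x y => x = mk (a * c) ∧ y = mk (c * a))

/-- `N1 = M/(ac = ca)`. -/
abbrev N1 := con1.Quotient

/-- The congruence on `M` generated by the pair `(bacb, cbab)`. -/
def con2 : Con M := conGen (fun x y => x = mk (b * a * c * b) ∧ y = mk (c * b * a * b))

/-- The grammic monoid `N2 = M/(bacb = cbab)`. -/
abbrev N2 := con2.Quotient



set_option linter.unusedSimpArgs false

/-- The right action of words on states, given by letter steps. -/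
def act {S : Type} (f : Fin 3 → S → S) : FreeMonoid (Fin 3) →* (Function.End S)ᵐᵒᵖ :=
  FreeMonoid.lift (fun i => MulOpposite.op (f i : Function.End S))

/-- The state reached from `s` after reading `w`. -/
def run {S : Type} (f : Fin 3 → S → S) (s : S) (w : FreeMonoid (Fin 3)) : S :=
  (act f w).unop s

theorem run_mul {S : Type} (f : Fin 3 → S → S) (s : S) (v w : FreeMonoid (Fin 3)) :
    run f s (v * w) = run f (run f s v) w := by
  simp only [run, map_mul, MulOpposite.unop_mul]
  rfl

theorem run_of {S : Type} (f : Fin 3 → S → S) (s : S) (i : Fin 3) :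
    run f s (FreeMonoid.of i) = f i s := by
  simp only [run, act, FreeMonoid.lift_eval_of]
  rfl

theorem act_ext {S : Type} (f : Fin 3 → S → S) {v w : FreeMonoid (Fin 3)}
    (h : ∀ s, run f s v = run f s w) : act f v = act f w := by
  apply MulOpposite.unop_injective
  funext s
  exact h s

/-- If the steps respect the Knuth relations, the action descends to `M`. -/
def actM {S : Type} (f : Fin 3 → S → S)
    (h : ∀ x y, KnuthRel x y → ∀ s, run f s x = run f s y) :
    M →* (Function.End S)ᵐᵒᵖ :=
  placticCon.lift (act f) (Con.conGen_le.2 (fun x y hxy => act_ext f (h x y hxy)))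

theorem actM_mk {S : Type} (f : Fin 3 → S → S)
    (h : ∀ x y, KnuthRel x y → ∀ s, run f s x = run f s y) (w : FreeMonoid (Fin 3)) :
    actM f h (mk w) = act f w := rfl

/-- A relation on `M` respected by the steps yields invariance under the generated congruence. -/
theorem run_eq_of_con {S : Type} (f : Fin 3 → S → S)
    (h : ∀ x y, KnuthRel x y → ∀ s, run f s x = run f s y)
    (p q : FreeMonoid (Fin 3)) (hpq : ∀ s, run f s p = run f s q)
    (v w : FreeMonoid (Fin 3))
    (hvw : conGen (fun x y => x = mk p ∧ y = mk q) (mk v) (mk w)) (s : S) :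
    run f s v = run f s w := by
  have hle : conGen (fun x y => x = mk p ∧ y = mk q) ≤ Con.ker (actM f h) := by
    apply Con.conGen_le.2
    rintro x y ⟨rfl, rfl⟩
    exact act_ext f hpq
  have := hle hvw
  have h2 : act f v = act f w := this
  simp only [run, h2]

/-- Steps on `(#c, D, l)` where `D`, `l` count the `cb` and `cba` columns. -/
def step1 : Fin 3 → ℕ × ℕ × ℕ → ℕ × ℕ × ℕ
  | 0, (n, d, l) => (n, min d n, min (l + 1) (min d n))
  | 1, (n, d, l) => (n, min (d + 1) n, min l (min d n))
  | 2, (n, d, l) => (n + 1, min d n, min l (min d n))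

/-- Steps on `(#a, #b, #c, L12, L23, L123)`. -/
def step2 : Fin 3 → ℕ × ℕ × ℕ × ℕ × ℕ × ℕ → ℕ × ℕ × ℕ × ℕ × ℕ × ℕ
  | 0, (x, y, z, u, v, w) =>
    (x + 1, y, z, max u (x + 1), max v y, max w (max u (x + 1)))
  | 1, (x, y, z, u, v, w) =>
    (x, y + 1, z, max u x + 1, max v (y + 1), max w (max u x + 1))
  | 2, (x, y, z, u, v, w) =>
    (x, y, z + 1, max u x, max v y + 1, max w (max u x) + 1)

theorem knuth1 : ∀ x y, KnuthRel x y → ∀ s, run step1 s x = run step1 s y := by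
  rintro x y h ⟨n, d, l⟩
  cases h <;>
  · simp only [a, b, c, run_mul, run_of, step1, Prod.mk.injEq, true_and]
    try omega

theorem knuth2 : ∀ x y, KnuthRel x y → ∀ s, run step2 s x = run step2 s y := by
  rintro x y h ⟨x, y, z, u, v, w⟩
  cases h <;>
  · simp only [a, b, c, run_mul, run_of, step2, Prod.mk.injEq, true_and]
    try omega

theorem run1_eq {v w : FreeMonoid (Fin 3)} (h : con1 (mk v) (mk w)) (s) :
    run step1 s v = run step1 s w := by
  refine run_eq_of_con step1 knuth1 _ _ ?_ v w h s
  rintro ⟨n, d, l⟩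
  simp only [a, c, run_mul, run_of, step1, Prod.mk.injEq, true_and]
  try omega

theorem run2_eq {v w : FreeMonoid (Fin 3)} (h : con2 (mk v) (mk w)) (s) :
    run step2 s v = run step2 s w := by
  refine run_eq_of_con step2 knuth2 _ _ ?_ v w h s
  rintro ⟨x, y, z, u, v, w⟩
  simp only [a, b, c, run_mul, run_of, step2, Prod.mk.injEq, true_and]
  try omega

theorem mk_rel {x y : FreeMonoid (Fin 3)} (h : KnuthRel x y) : mk x = mk y :=
  (Con.eq _).2 (ConGen.Rel.of _ _ h)


/-- The image of `a` in `M`. -/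
def A : M := mk a
/-- The image of `b` in `M`. -/
def B : M := mk b
/-- The image of `c` in `M`. -/
def C : M := mk c

theorem r_aba : A * B * A = B * A * A := mk_rel KnuthRel.aba
theorem r_bab : B * A * B = B * B * A := mk_rel KnuthRel.bab
theorem r_aca : A * C * A = C * A * A := mk_rel KnuthRel.aca
theorem r_cac : C * A * C = C * C * A := mk_rel KnuthRel.cac
theorem r_cbb : C * B * B = B * C * B := mk_rel KnuthRel.cbb
theorem r_cbc : C * B * C = C * C * B := mk_rel KnuthRel.cbc
theorem r_bac : B * A * C = B * C * A := mk_rel KnuthRel.bac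
theorem r_acb : A * C * B = C * A * B := mk_rel KnuthRel.acb

/-- Reassociated form of commutation of a two-letter column with another element. -/
theorem re_comm {x y z : M} (h : Commute (x * y) z) (k : M) :
    z * (x * (y * k)) = x * (y * (z * k)) := by
  have := congrArg (· * k) h.eq
  simp only [mul_assoc] at this
  exact this.symm

/-- Reassociated form of a three-letter relation. -/
theorem re3 {x y z x' y' z' : M} (h : x * y * z = x' * y' * z') (k : M) :
    x * (y * (z * k)) = x' * (y' * (z' * k)) := by
  have := congrArg (· * k) h
  simp only [mul_assoc] at this
  exact this

theorem comm_cba_a : Commute (C * B * A) A := by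
  show C * B * A * A = A * (C * B * A)
  calc C * B * A * A = C * (B * A * A) := by simp only [mul_assoc]
    _ = (C * A * B) * A := by rw [← r_aba]; simp only [mul_assoc]
    _ = A * (C * B * A) := by rw [← r_acb]; simp only [mul_assoc]

theorem comm_cba_b : Commute (C * B * A) B := by
  show C * B * A * B = B * (C * B * A)
  calc C * B * A * B = C * (B * A * B) := by simp only [mul_assoc]
    _ = (C * B * B) * A := by rw [r_bab]; simp only [mul_assoc]
    _ = B * (C * B * A) := by rw [r_cbb]; simp only [mul_assoc]

theorem comm_cba_c : Commute (C * B * A) C := by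
  show C * B * A * C = C * (C * B * A)
  calc C * B * A * C = C * (B * A * C) := by simp only [mul_assoc]
    _ = (C * B * C) * A := by rw [r_bac]; simp only [mul_assoc]
    _ = C * (C * B * A) := by rw [r_cbc]; simp only [mul_assoc]

theorem comm_ba_a : Commute (B * A) A := by
  show B * A * A = A * (B * A)
  rw [← r_aba, mul_assoc]
theorem comm_ba_b : Commute (B * A) B := by
  show B * A * B = B * (B * A)
  rw [r_bab, mul_assoc]
theorem comm_ca_a : Commute (C * A) A := by
  show C * A * A = A * (C * A)
  rw [← r_aca, mul_assoc]
theorem comm_ca_c : Commute (C * A) C := by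
  show C * A * C = C * (C * A)
  rw [r_cac, mul_assoc]
theorem comm_cb_b : Commute (C * B) B := by
  show C * B * B = B * (C * B)
  rw [r_cbb, mul_assoc]
theorem comm_cb_c : Commute (C * B) C := by
  show C * B * C = C * (C * B)
  rw [r_cbc, mul_assoc]

theorem cpow_b (u : ℕ) : C ^ (u + 1) * B = C * B * C ^ u := by
  rw [pow_succ, mul_assoc]; exact ((comm_cb_c.pow_right u).eq).symm

theorem cpow_a (u : ℕ) : C ^ (u + 1) * A = C * A * C ^ u := by
  rw [pow_succ, mul_assoc]; exact ((comm_ca_c.pow_right u).eq).symm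

theorem b_cpow_a (u : ℕ) : B * C ^ u * A = B * A * C ^ u := by
  cases u with
  | zero => simp
  | succ u =>
    rw [mul_assoc, cpow_a, ← mul_assoc, ← mul_assoc, ← r_bac, pow_succ' C u]
    simp only [mul_assoc]

theorem bpow_cpow_a (t u : ℕ) : B ^ (t + 1) * C ^ u * A = B * A * B ^ t * C ^ u := by
  rw [pow_succ, mul_assoc, mul_assoc, ← mul_assoc B, b_cpow_a, ← mul_assoc,
    ← (comm_ba_b.pow_right t).eq]

/-- Normal form: the column word of a tableau. -/
def nf (l p q r s t u : ℕ) : M :=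
  (C * B * A) ^ l * (B * A) ^ p * (C * A) ^ q * (C * B) ^ r * A ^ s * B ^ t * C ^ u

/-- Moving a `cba` column to the front. -/
theorem cba_front (l p q r : ℕ) :
    (C * B * A) ^ l * (B * A) ^ p * (C * A) ^ q * (C * B) ^ r * (C * B * A) =
    (C * B * A) ^ (l + 1) * (B * A) ^ p * (C * A) ^ q * (C * B) ^ r := by
  have h1 := (comm_cba_b.mul_right comm_cba_a).pow_right p
  have h2 := (comm_cba_c.mul_right comm_cba_a).pow_right q
  have h3 := (comm_cba_c.mul_right comm_cba_b).pow_right r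
  have h := (h1.mul_right h2).mul_right h3
  calc _ = (C * B * A) ^ l * (((B * A) ^ p * (C * A) ^ q * (C * B) ^ r) * (C * B * A)) := by
        simp only [mul_assoc]
    _ = _ := by rw [← h.eq, pow_succ]; simp only [mul_assoc]

theorem nf_c (l p q r s t u : ℕ) : nf l p q r s t u * C = nf l p q r s t (u + 1) := by
  rw [nf, nf, pow_succ, ← mul_assoc]

theorem nf_b0 (l p q r s t : ℕ) : nf l p q r s t 0 * B = nf l p q r s (t + 1) 0 := by
  simp only [nf, pow_zero, mul_one, pow_succ, mul_assoc]

theorem nf_b1 (l p q r t u : ℕ) : nf l p q r 0 t (u + 1) * B = nf l p q (r + 1) 0 t u := by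
  rw [nf, nf, mul_assoc, cpow_b, pow_succ (C * B) r]
  have h := re_comm (comm_cb_b.pow_right t)
  simp only [mul_assoc, pow_zero, one_mul, h]

theorem nf_b2 (l p q s t u : ℕ) :
    nf l p q 0 (s + 1) t (u + 1) * B = nf l p (q + 1) 0 s (t + 1) u := by
  rw [nf, nf, mul_assoc, cpow_b, pow_succ (C * A) q, pow_succ A s, pow_succ' B t]
  have h := re_comm (comm_cb_b.pow_right t)
  have h2 := re_comm (comm_ca_a.pow_right s)
  have h3 := re3 r_acb
  simp only [mul_assoc, pow_zero, one_mul]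
  rw [h, h3, h2]

theorem nf_a0 (l p q s : ℕ) : nf l p q 0 s 0 0 * A = nf l p q 0 (s + 1) 0 0 := by
  simp only [nf, pow_zero, mul_one, pow_succ, mul_assoc]

theorem nf_a1 (l p q r : ℕ) : nf l p q (r + 1) 0 0 0 * A = nf (l + 1) p q r 0 0 0 := by
  simp only [nf, pow_zero, mul_one]
  rw [← cba_front, pow_succ (C * B) r]
  simp only [mul_assoc]

theorem nf_a2 (l p q s u : ℕ) :
    nf l p q 0 s 0 (u + 1) * A = nf l p (q + 1) 0 s 0 u := by
  rw [nf, nf, mul_assoc, cpow_a, pow_succ (C * A) q]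
  have h2 := re_comm (comm_ca_a.pow_right s)
  simp only [mul_assoc, pow_zero, one_mul]
  rw [h2]

theorem nf_a3 (l p q r u : ℕ) :
    nf l p q (r + 1) 0 0 (u + 1) * A = nf (l + 1) p q r 0 0 (u + 1) := by
  rw [nf, nf, ← cba_front, mul_assoc, cpow_a, pow_succ (C * B) r, pow_succ' C u]
  have h2 := re3 r_cbc
  have h3 := re3 r_bac
  simp only [mul_assoc, pow_zero, one_mul]
  rw [h3]

theorem nf_a4 (l p s t u : ℕ) :
    nf l p 0 0 s (t + 1) u * A = nf l (p + 1) 0 0 s t u := by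
  rw [nf, nf, mul_assoc, mul_assoc, ← mul_assoc (B ^ (t + 1)), bpow_cpow_a, pow_succ (B * A) p]
  have h2 := re_comm (comm_ba_a.pow_right s)
  simp only [mul_assoc, pow_zero, one_mul]
  rw [h2]

theorem nf_a5 (l p q s t u : ℕ) :
    nf l p (q + 1) 0 s (t + 1) u * A = nf (l + 1) p q 0 (s + 1) t u := by
  rw [nf, nf, ← cba_front, mul_assoc, mul_assoc, ← mul_assoc (B ^ (t + 1)), bpow_cpow_a,
    pow_succ (C * A) q, pow_succ' A s]
  have h2 := re_comm (comm_ba_a.pow_right s)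
  have h3 := re3 r_aba
  simp only [mul_assoc, pow_zero, one_mul]
  rw [h2, h3]

theorem nf_a6 (l p q r t u : ℕ) :
    nf l p q (r + 1) 0 (t + 1) u * A = nf (l + 1) p q r 0 (t + 1) u := by
  rw [nf, nf, ← cba_front, mul_assoc, mul_assoc, ← mul_assoc (B ^ (t + 1)), bpow_cpow_a,
    pow_succ (C * B) r, pow_succ' B t]
  have h3 := re3 r_bab
  simp only [mul_assoc, pow_zero, one_mul]
  rw [h3]

/-- The word `w` has the given tableau parameters. -/
def Good (w : FreeMonoid (Fin 3)) (l p q r s t u : ℕ) : Prop :=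
  (r = 0 ∨ s = 0) ∧ mk w = nf l p q r s t u ∧
  run step1 (0, 0, 0) w = (l + q + r + u, l + min q t + r, l) ∧
  run step2 (0, 0, 0, 0, 0, 0) w =
    (l + p + q + s, l + p + r + t, l + q + r + u, l + p + q + s + r + t,
      l + p + r + u + max q t, l + p + q + r + s + t + u)

theorem Good.step {w : FreeMonoid (Fin 3)} {l p q r s t u l' p' q' r' s' t' u' : ℕ}
    (i : Fin 3) (h : Good w l p q r s t u) (h0 : r' = 0 ∨ s' = 0)
    (h1 : nf l p q r s t u * mk (FreeMonoid.of i) = nf l' p' q' r' s' t' u')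
    (h2 : step1 i (l + q + r + u, l + min q t + r, l) =
      (l' + q' + r' + u', l' + min q' t' + r', l'))
    (h3 : step2 i (l + p + q + s, l + p + r + t, l + q + r + u, l + p + q + s + r + t,
      l + p + r + u + max q t, l + p + q + r + s + t + u) =
      (l' + p' + q' + s', l' + p' + r' + t', l' + q' + r' + u', l' + p' + q' + s' + r' + t',
      l' + p' + r' + u' + max q' t', l' + p' + q' + r' + s' + t' + u')) :
    Good (w * FreeMonoid.of i) l' p' q' r' s' t' u' := by
  obtain ⟨-, g1, g2, g3⟩ := h
  exact ⟨h0, by rw [map_mul, g1, h1], by rw [run_mul, g2, run_of, h2],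
    by rw [run_mul, g3, run_of, h3]⟩

theorem good_step (w : FreeMonoid (Fin 3)) (i : Fin 3) {l p q r s t u : ℕ}
    (h : Good w l p q r s t u) :
    ∃ l' p' q' r' s' t' u', Good (w * FreeMonoid.of i) l' p' q' r' s' t' u' := by
  have h0 := h.1
  fin_cases i
  · rcases t with _ | t
    · rcases u with _ | u
      · rcases r with _ | r
        · exact ⟨_, _, _, _, _, _, _, h.step 0 (by omega) (nf_a0 ..)
            (by simp only [step1, Prod.mk.injEq, true_and]; omega)
            (by simp only [step2, Prod.mk.injEq, true_and]; omega)⟩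
        · obtain rfl : s = 0 := by omega
          exact ⟨_, _, _, _, _, _, _, h.step 0 (by omega) (nf_a1 ..)
            (by simp only [step1, Prod.mk.injEq, true_and]; omega)
            (by simp only [step2, Prod.mk.injEq, true_and]; omega)⟩
      · rcases r with _ | r
        · exact ⟨_, _, _, _, _, _, _, h.step 0 (by omega) (nf_a2 ..)
            (by simp only [step1, Prod.mk.injEq, true_and]; omega)
            (by simp only [step2, Prod.mk.injEq, true_and]; omega)⟩
        · obtain rfl : s = 0 := by omega
          exact ⟨_, _, _, _, _, _, _, h.step 0 (by omega) (nf_a3 ..)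
            (by simp only [step1, Prod.mk.injEq, true_and]; omega)
            (by simp only [step2, Prod.mk.injEq, true_and]; omega)⟩
    · rcases r with _ | r
      · rcases q with _ | q
        · exact ⟨_, _, _, _, _, _, _, h.step 0 (by omega) (nf_a4 ..)
            (by simp only [step1, Prod.mk.injEq, true_and]; omega)
            (by simp only [step2, Prod.mk.injEq, true_and]; omega)⟩
        · exact ⟨_, _, _, _, _, _, _, h.step 0 (by omega) (nf_a5 ..)
            (by simp only [step1, Prod.mk.injEq, true_and]; omega)
            (by simp only [step2, Prod.mk.injEq, true_and]; omega)⟩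
      · obtain rfl : s = 0 := by omega
        exact ⟨_, _, _, _, _, _, _, h.step 0 (by omega) (nf_a6 ..)
          (by simp only [step1, Prod.mk.injEq, true_and]; omega)
          (by simp only [step2, Prod.mk.injEq, true_and]; omega)⟩
  · rcases u with _ | u
    · exact ⟨_, _, _, _, _, _, _, h.step 1 (by omega) (nf_b0 ..)
        (by simp only [step1, Prod.mk.injEq, true_and]; omega)
        (by simp only [step2, Prod.mk.injEq, true_and]; omega)⟩
    · rcases s with _ | s
      · exact ⟨_, _, _, _, _, _, _, h.step 1 (by omega) (nf_b1 ..)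
          (by simp only [step1, Prod.mk.injEq, true_and]; omega)
          (by simp only [step2, Prod.mk.injEq, true_and]; omega)⟩
      · obtain rfl : r = 0 := by omega
        exact ⟨_, _, _, _, _, _, _, h.step 1 (by omega) (nf_b2 ..)
          (by simp only [step1, Prod.mk.injEq, true_and]; omega)
          (by simp only [step2, Prod.mk.injEq, true_and]; omega)⟩
  · exact ⟨_, _, _, _, _, _, _, h.step 2 (by omega) (nf_c ..)
      (by simp only [step1, Prod.mk.injEq, true_and]; omega)
      (by simp only [step2, Prod.mk.injEq, true_and]; omega)⟩

theorem exists_good_mul (l' : List (Fin 3)) : ∀ w : FreeMonoid (Fin 3),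
    (∃ l p q r s t u, Good w l p q r s t u) →
    ∃ l p q r s t u, Good (w * FreeMonoid.ofList l') l p q r s t u := by
  induction l' with
  | nil => intro w h; simpa using h
  | cons i v ih =>
    rintro w ⟨l, p, q, r, s, t, u, h⟩
    have := ih _ (good_step w i h)
    rw [FreeMonoid.ofList_cons, ← mul_assoc]
    exact this

theorem exists_good (w : FreeMonoid (Fin 3)) : ∃ l p q r s t u, Good w l p q r s t u := by
  have h : ∃ l p q r s t u, Good 1 l p q r s t u := by
    refine ⟨0, 0, 0, 0, 0, 0, 0, Or.inl rfl, ?_, rfl, rfl⟩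
    simp [nf]
  have := exists_good_mul (FreeMonoid.toList w) 1 h
  rwa [one_mul, FreeMonoid.ofList_toList] at this

theorem main_inj (v w : FreeMonoid (Fin 3)) (h1 : con1 (mk v) (mk w))
    (h2 : con2 (mk v) (mk w)) : mk v = mk w := by
  obtain ⟨l, p, q, r, s, t, u, g0, g1, g2, g3⟩ := exists_good v
  obtain ⟨l', p', q', r', s', t', u', k0, k1, k2, k3⟩ := exists_good w
  have e1 := run1_eq h1 (0, 0, 0)
  have e2 := run2_eq h2 (0, 0, 0, 0, 0, 0)
  rw [g2, k2] at e1
  rw [g3, k3] at e2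
  simp only [Prod.mk.injEq] at e1 e2
  obtain ⟨-, -, rfl⟩ := e1
  obtain rfl : u = u' := by omega
  obtain rfl : p = p' := by omega
  obtain ⟨rfl, rfl⟩ : r = r' ∧ s = s' := by
    rcases g0 with rfl | rfl <;> rcases k0 with rfl | rfl <;> omega
  obtain rfl : t = t' := by omega
  obtain rfl : q = q' := by omega
  rw [g1, k1]

/-- The plactic monoid `M` is a subdirect product of its quotients `N1` and `N2`:
the homomorphism `M →* N1 × N2` built from the two quotient projections is
injective, and each projection is surjective. -/
theorem subdirect_product :
    Function.Injective (MonoidHom.prod con1.mk' con2.mk') ∧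
    Function.Surjective con1.mk' ∧ Function.Surjective con2.mk' := by
  refine ⟨?_, Con.mk'_surjective, Con.mk'_surjective⟩
  intro x y h
  obtain ⟨v, rfl⟩ : ∃ v, mk v = x := Con.mk'_surjective x
  obtain ⟨w, rfl⟩ : ∃ w, mk w = y := Con.mk'_surjective y
  have h' := Prod.mk.inj h
  exact main_inj v w ((Con.eq _).1 h'.1) ((Con.eq _).1 h'.2)

end Plactic
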